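/- Let p be a binary path of length L satisfying the suffix condition: for every i, #{a ∈ [i, L] : p_a = 1} ≤ #{a ∈ [i, L] : p_a = 0}. Let (ν, J) be its rigged configuration with vacancy numbers P_i(ν) = L − 2Q_i(ν). Then the configuration of the N-fold concatenation p^{⊗N} = p·p·⋯·p under the RC-bijection is ν ∪ ν ∪ ⋯ ∪ ν (N copies), and its riggings attached to rows of length i are {J_{k,i} + a·P_i(ν) : 0 ≤ a ≤ N−1, 1 ≤ k ≤ m_i(ν)}. -/

import Mathlib

/-- `Q_i(ν) = Σ_a min(i, ν_a)`, where the configuration is recorded as a list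
of (row length, rigging) pairs. -/
def Qcfg (ν : List (ℕ × ℤ)) (i : ℕ) : ℤ := (ν.map (fun r => (min i r.1 : ℤ))).sum

/-- One step of the `A₁⁽¹⁾` rigged configuration bijection: processing the
letter `a` at (1-indexed) position `b` of the path, with `prev` the previous
letter.  A letter 0 does nothing; a letter 1 preceded by 0 creates a new
length-1 string with rigging `b - 2(ℓ(ν)+1)`; a letter 1 preceded by 1 adds a
box to a longest singular string (a row `(i, J)` with `J = (b-1) - 2 Q_i(ν)`,
the vacancy number of the length `b-1` prefix), the new rigging being
`b - 2 Σ_j min(i+1, ν_j)`. -/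
def rcStep (b : ℕ) (prev : Bool) (a : Bool) (ν : List (ℕ × ℤ)) : List (ℕ × ℤ) :=
  if a = false then ν
  else if prev = false then
    ((1 : ℕ), (b : ℤ) - 2 * ((ν.length : ℤ) + 1)) :: ν
  else
    match ((ν.filter (fun r => decide (r.2 = (b : ℤ) - 1 - 2 * Qcfg ν r.1))).map
        Prod.fst).max? with
    | none => ν
    | some i =>
      let ν' := ν.erase (i, (b : ℤ) - 1 - 2 * Qcfg ν i)
      ((i + 1 : ℕ), (b : ℤ) - 2 * (Qcfg ν' (i + 1) + ((i : ℤ) + 1))) :: ν'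

def rcAux : ℕ → Bool → List Bool → List (ℕ × ℤ) → List (ℕ × ℤ)
  | _, _, [], ν => ν
  | b, prev, a :: rest, ν => rcAux (b + 1) a rest (rcStep b prev a ν)

/-- The `A₁⁽¹⁾` rigged configuration bijection applied to a binary path
(`true` = 1, `false` = 0), returning the list of (row length, rigging) pairs. -/
def rcBij (p : List Bool) : List (ℕ × ℤ) := rcAux 1 false p []


lemma Qcfg_cons (r : ℕ × ℤ) (ν : List (ℕ × ℤ)) (k : ℕ) :
    Qcfg (r :: ν) k = min (k : ℤ) r.1 + Qcfg ν k := by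
  simp [Qcfg]

lemma Qcfg_append (A B : List (ℕ × ℤ)) (k : ℕ) :
    Qcfg (A ++ B) k = Qcfg A k + Qcfg B k := by
  simp [Qcfg]

lemma Qcfg_perm {A B : List (ℕ × ℤ)} (h : A.Perm B) (k : ℕ) : Qcfg A k = Qcfg B k :=
  (h.map _).sum_eq

lemma Qcfg_mapShift (B : List (ℕ × ℤ)) (g : ℕ → ℤ) (k : ℕ) :
    Qcfg (B.map (fun r => (r.1, r.2 + g r.1))) k = Qcfg B k := by
  simp [Qcfg, List.map_map, Function.comp_def]

lemma Qcfg_mono (ν : List (ℕ × ℤ)) {j k : ℕ} (h : j ≤ k) : Qcfg ν j ≤ Qcfg ν k := by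
  induction ν with
  | nil => simp [Qcfg]
  | cons r ν ih => rw [Qcfg_cons, Qcfg_cons]; omega

lemma Qcfg_one (ν : List (ℕ × ℤ)) (h : ∀ r ∈ ν, 1 ≤ r.1) : Qcfg ν 1 = ν.length := by
  induction ν with
  | nil => simp [Qcfg]
  | cons r ν ih =>
    rw [Qcfg_cons, ih (fun s hs => h s (by simp [hs]))]
    have := h r (by simp)
    simp only [List.length_cons]
    omega

lemma Qcfg_const (ν : List (ℕ × ℤ)) {j k : ℕ} (h : j ≤ k) (hm : ∀ r ∈ ν, r.1 ≤ j) :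
    Qcfg ν k = Qcfg ν j := by
  induction ν with
  | nil => simp [Qcfg]
  | cons r ν ih =>
    rw [Qcfg_cons, Qcfg_cons, ih (fun s hs => hm s (by simp [hs]))]
    have := hm r (by simp)
    omega

lemma Qcfg_erase (ν : List (ℕ × ℤ)) {r : ℕ × ℤ} (h : r ∈ ν) (k : ℕ) :
    Qcfg ν k = min (k : ℤ) r.1 + Qcfg (ν.erase r) k := by
  rw [Qcfg_perm (List.perm_cons_erase h) k, Qcfg_cons]

/-- Invariant of the algorithm after `n` letters; `m` is the maximal excess of 1s
over 0s among suffixes. -/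
structure RCInv (n m : ℕ) (prev : Bool) (ν : List (ℕ × ℤ)) : Prop where
  pos : ∀ r ∈ ν, 1 ≤ r.1
  lower : ∀ r ∈ ν, -(r.1 : ℤ) ≤ r.2
  upper : ∀ r ∈ ν, r.2 ≤ (n : ℤ) - 2 * Qcfg ν r.1
  strict : prev = false → ∀ r ∈ ν, r.2 < (n : ℤ) - 2 * Qcfg ν r.1
  sing : prev = true → ∃ r ∈ ν, r.2 = (n : ℤ) - 2 * Qcfg ν r.1
  cor : ∀ r ∈ ν, (r.1 : ℤ) - m ≤ (n : ℤ) - 2 * Qcfg ν r.1 - r.2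
  last : prev = true → 1 ≤ m

lemma RCInv.key {n m : ℕ} {prev : Bool} {ν : List (ℕ × ℤ)} (h : RCInv n m prev ν) {k : ℕ}
    (hk : 1 ≤ k) (hP : (n : ℤ) - 2 * Qcfg ν k ≤ -(k : ℤ)) :
    (k, (n : ℤ) - 2 * Qcfg ν k) ∈ ν := by
  rcases Decidable.em (ν = []) with h0 | h0
  · subst h0
    simp [Qcfg] at hP
    omega
  · obtain ⟨r, hr, hmax⟩ := ν.toFinset.exists_max_image (fun r => r.1)
      (by simpa using h0)
    simp only [List.mem_toFinset] at hr hmax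
    have h1 := h.lower r hr
    have h2 := h.upper r hr
    rcases le_or_gt k r.1 with hle | hlt
    · have e1 := Qcfg_erase ν hr k
      have e2 := Qcfg_erase ν hr r.1
      have e3 := Qcfg_mono (ν.erase r) hle
      have : k = r.1 := by omega
      subst this
      have : (n : ℤ) - 2 * Qcfg ν r.1 = r.2 := by omega
      rw [this]
      exact hr
    · have := Qcfg_const ν hlt.le hmax
      omega

lemma rcStep_spec (n : ℕ) (ν : List (ℕ × ℤ)) (i : ℕ)
    (hi : (i, (n : ℤ) - 2 * Qcfg ν i) ∈ ν)
    (hmax : ∀ r ∈ ν, r.2 = (n : ℤ) - 2 * Qcfg ν r.1 → r.1 ≤ i) :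
    rcStep (n + 1) true true ν =
      (i + 1, (n : ℤ) + 1 - 2 * (Qcfg (ν.erase (i, (n : ℤ) - 2 * Qcfg ν i)) (i + 1)
        + ((i : ℤ) + 1))) :: ν.erase (i, (n : ℤ) - 2 * Qcfg ν i) := by
  have e : ((n + 1 : ℕ) : ℤ) - 1 = n := by push_cast; ring
  have : ((ν.filter (fun r => decide (r.2 = ((n + 1 : ℕ) : ℤ) - 1 - 2 * Qcfg ν r.1))).map
        Prod.fst).max? = some i := by
    rw [List.max?_eq_some_iff, e]
    constructor
    · simp only [List.mem_map, List.mem_filter, decide_eq_true_eq]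
      exact ⟨_, ⟨hi, rfl⟩, rfl⟩
    · intro b hb
      simp only [List.mem_map, List.mem_filter, decide_eq_true_eq] at hb
      obtain ⟨r, ⟨hr, hs⟩, rfl⟩ := hb
      exact hmax r hr hs
  unfold rcStep
  rw [this]
  simp

lemma exists_max_sing (n : ℕ) (ν : List (ℕ × ℤ))
    (hs : ∃ r ∈ ν, r.2 = (n : ℤ) - 2 * Qcfg ν r.1) :
    ∃ i : ℕ, (i, (n : ℤ) - 2 * Qcfg ν i) ∈ ν ∧
      ∀ r ∈ ν, r.2 = (n : ℤ) - 2 * Qcfg ν r.1 → r.1 ≤ i := by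
  obtain ⟨r0, h0, h0'⟩ := hs
  obtain ⟨r, hr, hmax⟩ := (ν.toFinset.filter
    (fun r => r.2 = (n : ℤ) - 2 * Qcfg ν r.1)).exists_max_image (fun r => r.1)
      ⟨r0, by simp [h0, ← h0']⟩
  simp only [Finset.mem_filter, List.mem_toFinset] at hr hmax
  refine ⟨r.1, ?_, fun s hs hs' => hmax s ⟨hs, hs'⟩⟩
  rw [← hr.2]
  exact hr.1

/-- Evolution of the maximal suffix excess. -/
def mstep (m : ℕ) (a : Bool) : ℕ := if a then m + 1 else m - 1

lemma RCInv.step {n m : ℕ} {prev : Bool} {ν : List (ℕ × ℤ)} (h : RCInv n m prev ν) (a : Bool) :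
    RCInv (n + 1) (mstep m a) a (rcStep (n + 1) prev a ν) := by
  cases a with
  | false =>
    have e : rcStep (n + 1) prev false ν = ν := by simp [rcStep]
    rw [e]
    refine ⟨h.pos, h.lower, ?_, ?_, by simp, ?_, by simp⟩
    · intro r hr
      have := h.upper r hr
      push_cast; omega
    · intro _ r hr
      have := h.upper r hr
      push_cast; omega
    · intro r hr
      have h1 := h.upper r hr
      have h2 := h.cor r hr
      have h3 := h.pos r hr
      simp only [mstep]
      push_cast
      omega
  | true =>
    cases prev with
    | false =>
      have e : rcStep (n + 1) false true ν
          = (1, (n : ℤ) + 1 - 2 * ((ν.length : ℤ) + 1)) :: ν := by simp [rcStep]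
      rw [e]
      have hQ1 := Qcfg_one ν h.pos
      have hP1 : 0 ≤ (n : ℤ) - 2 * Qcfg ν 1 := by
        by_contra hc
        have := h.key (k := 1) le_rfl (by push_cast; omega)
        have := h.strict rfl _ this
        simp at this
      have hst := h.strict rfl
      constructor
      · intro r hr
        rcases List.mem_cons.1 hr with rfl | hr
        · simp
        · exact h.pos r hr
      · intro r hr
        rcases List.mem_cons.1 hr with rfl | hr
        · push_cast; omega
        · exact h.lower r hr
      · intro r hr
        rw [Qcfg_cons]
        rcases List.mem_cons.1 hr with rfl | hr
        · push_cast; simp only [hQ1]; omega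
        · have h1 := h.pos r hr
          have h2 := hst r hr
          push_cast; omega
      · simp
      · intro _
        refine ⟨_, List.mem_cons_self, ?_⟩
        rw [Qcfg_cons]
        push_cast; simp only [hQ1]; omega
      · intro r hr
        rw [Qcfg_cons]
        simp only [mstep, if_true]
        rcases List.mem_cons.1 hr with rfl | hr
        · push_cast; simp only [hQ1]; omega
        · have h1 := h.pos r hr
          have h2 := h.cor r hr
          push_cast; omega
      · simp [mstep]
    | true =>
      obtain ⟨i, hi, hmax⟩ := exists_max_sing n ν (h.sing rfl)
      rw [rcStep_spec n ν i hi hmax]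
      set y := (i, (n : ℤ) - 2 * Qcfg ν i) with hy
      have hQ : ∀ k, Qcfg ν k = min (k : ℤ) i + Qcfg (ν.erase y) k := fun k =>
        Qcfg_erase ν hi k
      have hP1 : -(i : ℤ) ≤ (n : ℤ) - 2 * Qcfg ν (i + 1) := by
        by_contra hc
        have := h.key (k := i + 1) (by omega) (by push_cast; omega)
        have := hmax _ this rfl
        simp at this
      have hci : (i : ℤ) - m ≤ (n : ℤ) - 2 * Qcfg ν i - ((n : ℤ) - 2 * Qcfg ν i) := h.cor y hi
      have hQi := hQ (i + 1)
      have hsub : ∀ r ∈ ν.erase y, r ∈ ν := fun r hr => List.mem_of_mem_erase hr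
      constructor
      · intro r hr
        rcases List.mem_cons.1 hr with rfl | hr
        · simp
        · exact h.pos r (hsub r hr)
      · intro r hr
        rcases List.mem_cons.1 hr with rfl | hr
        · push_cast at *; omega
        · exact h.lower r (hsub r hr)
      · intro r hr
        rw [Qcfg_cons]
        rcases List.mem_cons.1 hr with rfl | hr
        · push_cast; omega
        · have h1 := h.upper r (hsub r hr)
          have h2 := hmax r (hsub r hr)
          have h3 := hQ r.1
          push_cast; omega
      · simp
      · intro _
        refine ⟨_, List.mem_cons_self, ?_⟩
        rw [Qcfg_cons]
        push_cast; omega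
      · intro r hr
        rw [Qcfg_cons]
        simp only [mstep, if_true]
        rcases List.mem_cons.1 hr with rfl | hr
        · push_cast; omega
        · have h1 := h.cor r (hsub r hr)
          have h3 := hQ r.1
          push_cast; omega
      · simp [mstep]

/-- The concatenation step. -/
lemma glue_step {L mA n m : ℕ} {pA prev : Bool} {A B X : List (ℕ × ℤ)}
    (hA : RCInv L mA pA A) (hm : mA = 0) (hB : RCInv n m prev B)
    (hX : X.Perm (A ++ B.map (fun r => (r.1, r.2 + ((L : ℤ) - 2 * Qcfg A r.1))))) (a : Bool) :
    (rcStep (L + n + 1) prev a X).Perm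
      (A ++ (rcStep (n + 1) prev a B).map (fun r => (r.1, r.2 + ((L : ℤ) - 2 * Qcfg A r.1)))) := by
  subst hm
  set f : ℕ × ℤ → ℕ × ℤ := fun r => (r.1, r.2 + ((L : ℤ) - 2 * Qcfg A r.1)) with hf
  have hQX : ∀ k, Qcfg X k = Qcfg A k + Qcfg B k := by
    intro k
    rw [Qcfg_perm hX, Qcfg_append, hf, Qcfg_mapShift B (fun j => (L : ℤ) - 2 * Qcfg A j)]
  cases a with
  | false => simpa [rcStep] using hX
  | true =>
    cases prev with
    | false =>
      have e1 : rcStep (L + n + 1) false true X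
          = (1, (L : ℤ) + n + 1 - 2 * ((X.length : ℤ) + 1)) :: X := by simp [rcStep]
      have e2 : rcStep (n + 1) false true B
          = (1, (n : ℤ) + 1 - 2 * ((B.length : ℤ) + 1)) :: B := by simp [rcStep]
      rw [e1, e2, List.map_cons]
      have e3 : ((1 : ℕ), (L : ℤ) + n + 1 - 2 * ((X.length : ℤ) + 1))
          = f (1, (n : ℤ) + 1 - 2 * ((B.length : ℤ) + 1)) := by
        simp only [hf, Qcfg_one A hA.pos, hX.length_eq, List.length_append, List.length_map]
        push_cast
        congr 1
        ring
      rw [e3]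
      exact (hX.cons _).trans List.perm_middle.symm
    | true =>
      obtain ⟨i, hi, hmax⟩ := exists_max_sing n B (hB.sing rfl)
      have hfy : f (i, (n : ℤ) - 2 * Qcfg B i) = (i, ((L + n : ℕ) : ℤ) - 2 * Qcfg X i) := by
        simp only [hf, hQX]
        push_cast
        congr 1
        ring
      have hiX : (i, ((L + n : ℕ) : ℤ) - 2 * Qcfg X i) ∈ X := by
        rw [hX.mem_iff, ← hfy]
        exact List.mem_append_right _ (List.mem_map_of_mem hi)
      have hmaxX : ∀ r ∈ X, r.2 = ((L + n : ℕ) : ℤ) - 2 * Qcfg X r.1 → r.1 ≤ i := by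
        intro r hr hs
        rw [hQX] at hs
        push_cast at hs
        rw [hX.mem_iff, List.mem_append] at hr
        rcases hr with hr | hr
        · have h1 := hA.cor r hr
          have h2 := hB.key (hA.pos r hr) (by push_cast at h1; omega)
          exact hmax (r.1, (n : ℤ) - 2 * Qcfg B r.1) h2 rfl
        · obtain ⟨s, hs', rfl⟩ := List.mem_map.1 hr
          simp only [hf] at hs ⊢
          exact hmax s hs' (by omega)
      rw [rcStep_spec (L + n) X i hiX hmaxX, rcStep_spec n B i hi hmax, List.map_cons]
      rw [← hfy]
      set y := (i, (n : ℤ) - 2 * Qcfg B i) with hy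
      have hp : (X.erase (f y)).Perm (A ++ (B.erase y).map f) := by
        have h1 : (f y :: X.erase (f y)).Perm X :=
          (List.perm_cons_erase (hfy ▸ hiX)).symm
        have h2 : (A ++ B.map f).Perm (f y :: (A ++ (B.erase y).map f)) := by
          have := (List.perm_cons_erase hi).map f
          rw [List.map_cons] at this
          exact (this.append_left A).trans List.perm_middle
        exact ((h1.trans hX).trans h2).cons_inv
      have e3 : ((i + 1 : ℕ), ((L + n : ℕ) : ℤ) + 1 - 2 * (Qcfg (X.erase (f y)) (i + 1)
          + ((i : ℤ) + 1)))
          = f (i + 1, (n : ℤ) + 1 - 2 * (Qcfg (B.erase y) (i + 1) + ((i : ℤ) + 1))) := by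
        have : Qcfg (X.erase (f y)) (i + 1) = Qcfg A (i + 1) + Qcfg (B.erase y) (i + 1) := by
          rw [Qcfg_perm hp, Qcfg_append, hf,
            Qcfg_mapShift (B.erase y) (fun j => (L : ℤ) - 2 * Qcfg A j)]
        rw [this]
        simp only [hf]
        push_cast
        congr 1
        ring
      rw [e3]
      exact (hp.cons _).trans List.perm_middle.symm

lemma glue_aux {L : ℕ} {pA : Bool} {A : List (ℕ × ℤ)} (hA : RCInv L 0 pA A) (r : List Bool) :
    ∀ (n m : ℕ) (prev : Bool) (B X : List (ℕ × ℤ)), RCInv n m prev B →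
    X.Perm (A ++ B.map (fun r => (r.1, r.2 + ((L : ℤ) - 2 * Qcfg A r.1)))) →
    (rcAux (L + n + 1) prev r X).Perm
      (A ++ (rcAux (n + 1) prev r B).map
        (fun r => (r.1, r.2 + ((L : ℤ) - 2 * Qcfg A r.1)))) := by
  induction r with
  | nil => intro n m prev B X _ hX; simpa [rcAux] using hX
  | cons a r ih =>
    intro n m prev B X hB hX
    simp only [rcAux]
    exact ih (n + 1) _ a _ _ (hB.step a) (glue_step hA rfl hB hX a)

/-- Last letter, with a default. -/
def lastL (prev : Bool) (q : List Bool) : Bool := q.foldl (fun _ a => a) prev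

lemma rcAux_append (q r : List Bool) : ∀ (b : ℕ) (prev : Bool) (ν : List (ℕ × ℤ)),
    rcAux b prev (q ++ r) ν = rcAux (b + q.length) (lastL prev q) r (rcAux b prev q ν) := by
  induction q with
  | nil => intro b prev ν; simp [rcAux, lastL]
  | cons a q ih =>
    intro b prev ν
    simp only [List.cons_append, rcAux, ih, List.length_cons, lastL, List.foldl_cons]
    congr 1
    omega

lemma RCInv.run (q : List Bool) : ∀ (n m : ℕ) (prev : Bool) (ν : List (ℕ × ℤ)), RCInv n m prev ν →
    RCInv (n + q.length) (q.foldl mstep m) (lastL prev q) (rcAux (n + 1) prev q ν) := by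
  induction q with
  | nil => intro n m prev ν h; simpa [rcAux, lastL] using h
  | cons a q ih =>
    intro n m prev ν h
    have := ih (n + 1) _ a _ (h.step a)
    simp only [List.length_cons, List.foldl_cons, rcAux, lastL] at this ⊢
    rwa [show n + (q.length + 1) = n + 1 + q.length by omega]

lemma RCInv.start : RCInv 0 0 false [] := by
  constructor <;> simp

lemma glue (q r : List Bool) (hq : q.foldl mstep 0 = 0) :
    (rcBij (q ++ r)).Perm (rcBij q ++ (rcBij r).map
        (fun s => (s.1, s.2 + ((q.length : ℤ) - 2 * Qcfg (rcBij q) s.1)))) := by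
  have hA := RCInv.run q 0 0 false [] RCInv.start
  rw [hq, Nat.zero_add] at hA
  have hl : lastL false q = false := by
    by_contra hc
    have := hA.last (by simpa using hc)
    omega
  have := glue_aux hA r 0 0 false [] (rcAux 1 false q []) RCInv.start (by simp)
  unfold rcBij
  rw [rcAux_append, hl]
  simpa [Nat.add_comm] using this

lemma exists_suffix (p : List Bool) :
    ∃ s, s <:+ p ∧ p.foldl mstep 0 + s.count false = s.count true ∨
      p.foldl mstep 0 = 0 := by
  induction p using List.reverseRecOn with
  | nil => exact ⟨[], Or.inr rfl⟩
  | append_singleton p a ih =>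
    obtain ⟨s, hs⟩ := ih
    rw [List.foldl_append]
    simp only [List.foldl_cons, List.foldl_nil]
    cases a with
    | true =>
      rcases hs with ⟨⟨t, rfl⟩, hs⟩ | hs
      · refine ⟨s ++ [true], Or.inl ⟨⟨t, by simp⟩, ?_⟩⟩
        simp [mstep] at hs ⊢
        omega
      · refine ⟨[true], Or.inl ⟨⟨p, by simp⟩, ?_⟩⟩
        simp [mstep, hs]
    | false =>
      by_cases h0 : p.foldl mstep 0 ≤ 1
      · refine ⟨[], Or.inr ?_⟩
        simp only [mstep, Bool.false_eq_true, if_false]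
        omega
      · rcases hs with ⟨⟨t, rfl⟩, hs⟩ | hs
        · refine ⟨s ++ [false], Or.inl ⟨⟨t, by simp⟩, ?_⟩⟩
          simp [mstep] at hs h0 ⊢
          omega
        · omega

lemma foldl_zero (p : List Bool)
    (h : ∀ i, (p.drop i).count true ≤ (p.drop i).count false) : p.foldl mstep 0 = 0 := by
  obtain ⟨s, ⟨⟨t, rfl⟩, hs⟩ | hs⟩ := exists_suffix p
  · have := h t.length
    simp only [List.drop_left] at this
    omega
  · exact hs

lemma foldl_rep (p : List Bool) (h : p.foldl mstep 0 = 0) (N : ℕ) :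
    (List.replicate N p).flatten.foldl mstep 0 = 0 := by
  induction N with
  | zero => simp
  | succ N ih => rw [List.replicate_succ, List.flatten_cons, List.foldl_append, h, ih]

lemma rep_succ (p : List Bool) (N : ℕ) :
    (List.replicate (N + 1) p).flatten = (List.replicate N p).flatten ++ p := by
  rw [List.replicate_succ', List.flatten_append]; simp

lemma Qcfg_rep (p : List Bool) (h : p.foldl mstep 0 = 0) (N k : ℕ) :
    Qcfg (rcBij (List.replicate N p).flatten) k = N * Qcfg (rcBij p) k := by
  induction N with
  | zero => simp [rcBij, rcAux, Qcfg]
  | succ N ih =>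
    rw [rep_succ, Qcfg_perm (glue _ p (foldl_rep p h N)), Qcfg_append, ih,
      Qcfg_mapShift (rcBij p) (fun j => _ - 2 * Qcfg _ j)]
    push_cast
    ring

/-- For a path satisfying the suffix (Yamanouchi-type) condition, the rigged
configuration of the `N`-fold concatenation `p^{⊗N}` is `ν ∪ ⋯ ∪ ν` with
riggings `J_{k,i} + a·P_i(ν)`, `0 ≤ a ≤ N-1`, where
`P_i(ν) = L - 2 Q_i(ν)`. -/
theorem stmt14 (p : List Bool) (N : ℕ)
    (h : ∀ i, (p.drop i).count true ≤ (p.drop i).count false) :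
    (↑(rcBij (List.replicate N p).flatten) : Multiset (ℕ × ℤ))
      = ∑ a ∈ Finset.range N,
          (↑((rcBij p).map (fun r =>
              (r.1, r.2 + (a : ℤ) * ((p.length : ℤ) - 2 * Qcfg (rcBij p) r.1)))) :
            Multiset (ℕ × ℤ)) := by
  have h0 := foldl_zero p h
  induction N with
  | zero => simp [rcBij, rcAux]
  | succ N ih =>
    rw [Finset.sum_range_succ, ← ih, rep_succ, Multiset.coe_add, Multiset.coe_eq_coe]
    have := glue _ p (foldl_rep p h0 N)
    convert this using 5
    rw [Qcfg_rep p h0]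
    simp
    ring
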